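/- arXiv:2101.12268 — 2 statements merged into one kernel-verified Lean document; each statement's English description precedes it below -/
import Mathlib

section
/- Lemma 3.1. Let β ∈ (0,1] and let (a_n)_{n≥1} be a decreasing sequence of nonnegative reals. Let ρ : [1,∞) → (0,∞) be an increasing function such that x ↦ ρ(x)/x^γ is decreasing for some γ ∈ (0, 1/β). Suppose there exists B > 0 such that for every δ ∈ (0,1): ∑_{n≥1} h_{β,δ}(1/(Bρ(n))) ≤ ∑_{n≥1} h_{β,δ}(a_n) ≤ ∑_{n≥1} h_{β,δ}(B/ρ(n)). Then a_n ≍ 1/ρ(n), i.e., there exist constants c, C > 0 with c/ρ(n) ≤ a_n ≤ C/ρ(n) for all n ≥ 1. -/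
open Filter Set
open scoped ENNReal Topology

/-- The partial sums of `n ↦ n ^ (-θ)` are at most `n ^ (1 - θ) / (1 - θ)`. -/
lemma sum_range_rpow_neg_le {θ : ℝ} (h0 : 0 ≤ θ) (h1 : θ < 1) (n : ℕ) :
    ∑ m ∈ Finset.range n, ((m : ℝ) + 1) ^ (-θ) ≤ (n : ℝ) ^ (1 - θ) / (1 - θ) := by
  have hp : 0 < 1 - θ := by linarith
  induction n with
  | zero => simp [Real.zero_rpow hp.ne']
  | succ n ih =>
    rw [Finset.sum_range_succ]
    have hx : (0 : ℝ) < n + 1 := by positivity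
    have hs : -1 ≤ -(1 / ((n : ℝ) + 1)) := by
      rw [neg_le_neg_iff, div_le_one hx]
      linarith [n.cast_nonneg (α := ℝ)]
    have bernoulli := rpow_one_add_le_one_add_mul_self hs hp.le (by linarith)
    have hn : (n : ℝ) = (n + 1) * (1 + -(1 / ((n : ℝ) + 1))) := by
      field_simp
      ring
    have hpow : (n : ℝ) ^ (1 - θ) =
        ((n : ℝ) + 1) ^ (1 - θ) * (1 + -(1 / ((n : ℝ) + 1))) ^ (1 - θ) := by
      rw [← Real.mul_rpow hx.le (by linarith), ← hn]
    have hneg : ((n : ℝ) + 1) ^ (-θ) = ((n : ℝ) + 1) ^ (1 - θ) / (n + 1) := by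
      rw [← Real.rpow_sub_one hx.ne']
      congr 1
      ring
    have hle : (n : ℝ) ^ (1 - θ) + (1 - θ) * ((n : ℝ) + 1) ^ (-θ) ≤
        ((n : ℝ) + 1) ^ (1 - θ) := by
      have := mul_le_mul_of_nonneg_left bernoulli (Real.rpow_nonneg hx.le (1 - θ))
      rw [← hpow] at this
      rw [hneg]
      calc _ ≤ _ := add_le_add_left this _
        _ = _ := by ring
    push_cast
    calc _ ≤ (n : ℝ) ^ (1 - θ) / (1 - θ) + ((n : ℝ) + 1) ^ (-θ) := by gcongr
      _ = ((n : ℝ) ^ (1 - θ) + (1 - θ) * ((n : ℝ) + 1) ^ (-θ)) / (1 - θ) := by field_simp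
      _ ≤ _ := by gcongr

/-- If `(n + 1) ^ θ * b n` is increasing with `θ < 1`, the averages of `b` are comparable to `b`. -/
lemma sum_range_succ_le_of_growth {θ : ℝ} (h0 : 0 ≤ θ) (h1 : θ < 1) {b : ℕ → ℝ}
    (hgrow : Monotone fun n : ℕ => ((n : ℝ) + 1) ^ θ * b n) (hb : ∀ n, 0 ≤ b n) (n : ℕ) :
    ∑ m ∈ Finset.range (n + 1), b m ≤ (n + 1) * b n / (1 - θ) := by
  have hx : (0 : ℝ) < n + 1 := by positivity
  calc ∑ m ∈ Finset.range (n + 1), b m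
      ≤ ∑ m ∈ Finset.range (n + 1), (((n : ℝ) + 1) ^ θ * b n) * ((m : ℝ) + 1) ^ (-θ) := by
        refine Finset.sum_le_sum fun m hm => ?_
        have hm' : (0 : ℝ) < m + 1 := by positivity
        rw [Real.rpow_neg hm'.le, ← div_eq_mul_inv, le_div_iff₀ (by positivity), mul_comm]
        exact hgrow (Nat.lt_succ_iff.mp (Finset.mem_range.mp hm))
    _ = (((n : ℝ) + 1) ^ θ * b n) * ∑ m ∈ Finset.range (n + 1), ((m : ℝ) + 1) ^ (-θ) := by
        rw [Finset.mul_sum]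
    _ ≤ (((n : ℝ) + 1) ^ θ * b n) * (((n + 1 : ℕ) : ℝ) ^ (1 - θ) / (1 - θ)) := by
        have := hb n
        gcongr
        exact sum_range_rpow_neg_le h0 h1 _
    _ = (((n : ℝ) + 1) ^ θ * ((n : ℝ) + 1) ^ (1 - θ)) * b n / (1 - θ) := by
        push_cast
        ring
    _ = _ := by rw [← Real.rpow_add hx]; simp

/-- Comparison of truncated sums, for a truncation level that kills `v` from index `k` on. -/
lemma mul_sub_le_sum_of_tsum_le {u v : ℕ → ℝ} (hu : Antitone u) (hv : Antitone v)
    (hv0 : ∀ n, 0 ≤ v n) {δ : ℝ} (hδ : 0 ≤ δ) (n k : ℕ) (hk : v k ≤ δ)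
    (h : ∑' i, ENNReal.ofReal (max (u i - δ) 0) ≤ ∑' i, ENNReal.ofReal (max (v i - δ) 0)) :
    (n + 1) * (u n - δ) ≤ ∑ m ∈ Finset.range (k + 1), v m := by
  have hsum : ∑' i, ENNReal.ofReal (max (v i - δ) 0) =
      ∑ i ∈ Finset.range (k + 1), ENNReal.ofReal (max (v i - δ) 0) := by
    refine tsum_eq_sum fun i hi => ?_
    have hki : k ≤ i := by
      rw [Finset.mem_range] at hi
      omega
    rw [max_eq_right (by linarith [hv hki]), ENNReal.ofReal_zero]
  have hle := (ENNReal.sum_le_tsum (Finset.range (n + 1))).trans (h.trans_eq hsum)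
  rw [← ENNReal.ofReal_sum_of_nonneg fun _ _ => le_max_right _ _,
    ← ENNReal.ofReal_sum_of_nonneg fun _ _ => le_max_right _ _,
    ENNReal.ofReal_le_ofReal_iff (Finset.sum_nonneg fun _ _ => le_max_right _ _)] at hle
  calc ((n : ℝ) + 1) * (u n - δ) = ∑ i ∈ Finset.range (n + 1), (u n - δ) := by simp [mul_sub]
    _ ≤ ∑ i ∈ Finset.range (n + 1), max (u i - δ) 0 :=
        Finset.sum_le_sum fun i hi => le_max_of_le_left <| sub_le_sub_right
          (hu (Nat.lt_succ_iff.mp (Finset.mem_range.mp hi))) _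
    _ ≤ _ := hle
    _ ≤ _ := Finset.sum_le_sum fun i _ => max_le (by linarith) (hv0 i)

/-- Two-sided comparison of `α` and `b` from the comparison of their truncated sums. -/
lemma comparable_of_truncated_sums {θ : ℝ} (h0 : 0 ≤ θ) (h1 : θ < 1) {α b : ℕ → ℝ}
    (hα : Antitone α) (hα0 : ∀ n, 0 ≤ α n) (hb : Antitone b) (hb0 : ∀ n, 0 < b n)
    (hgrow : Monotone fun n : ℕ => ((n : ℝ) + 1) ^ θ * b n) {c₁ c₂ : ℝ} (hc₁ : 0 < c₁) (hc₂ : 0 < c₂)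
    (hlower : ∀ δ ∈ Ioo (0 : ℝ) 1, ∑' n, ENNReal.ofReal (max (c₁ * b n - δ) 0) ≤
      ∑' n, ENNReal.ofReal (max (α n - δ) 0))
    (hupper : ∀ δ ∈ Ioo (0 : ℝ) 1, ∑' n, ENNReal.ofReal (max (α n - δ) 0) ≤
      ∑' n, ENNReal.ofReal (max (c₂ * b n - δ) 0)) :
    ∃ c > 0, ∃ C > 0, ∀ n, c * b n ≤ α n ∧ α n ≤ C * b n := by
  have hp : 0 < 1 - θ := by linarith
  have havg := sum_range_succ_le_of_growth h0 h1 hgrow fun n => (hb0 n).le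
  obtain ⟨C, hC, hαC⟩ : ∃ C > 0, ∀ n, α n ≤ C * b n := by
    refine ⟨c₂ * (1 + 1 / (1 - θ)) + α 0 * c₂, ?_, fun n => ?_⟩
    · have := hα0 0
      positivity
    have hbn := hb0 n
    have hα00 := hα0 0
    rcases lt_or_ge (c₂ * b n) 1 with hlt | hge
    · have key := mul_sub_le_sum_of_tsum_le hα (hb.const_mul hc₂.le)
        (fun m => (mul_pos hc₂ (hb0 m)).le) (mul_pos hc₂ hbn).le n n le_rfl
        (hupper _ ⟨mul_pos hc₂ hbn, hlt⟩)
      rw [← Finset.mul_sum] at key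
      have hx : (0 : ℝ) < n + 1 := by positivity
      have hbound : ((n : ℝ) + 1) * (α n - c₂ * b n) ≤ (n + 1) * (c₂ * b n / (1 - θ)) :=
        calc _ ≤ _ := key
          _ ≤ c₂ * ((n + 1) * b n / (1 - θ)) := by gcongr; exact havg n
          _ = _ := by ring
      have hdiv := le_of_mul_le_mul_left hbound hx
      have : 0 ≤ α 0 * c₂ * b n := by positivity
      calc α n ≤ c₂ * b n + c₂ * b n / (1 - θ) := by linarith
        _ = c₂ * (1 + 1 / (1 - θ)) * b n := by ring
        _ ≤ _ := by rw [add_mul]; linarith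
    · have h₁ : α n ≤ α 0 * (c₂ * b n) :=
        (hα (Nat.zero_le n)).trans (le_mul_of_one_le_right hα00 hge)
      have : 0 ≤ c₂ * (1 + 1 / (1 - θ)) * b n := by positivity
      rw [add_mul]
      linarith
  obtain ⟨K, hK, hK0⟩ : ∃ K : ℕ, C / (1 - θ) / (c₁ / 2) < (K : ℝ) ^ (1 - θ) ∧ 0 < K :=
    ((((tendsto_rpow_atTop hp).comp tendsto_natCast_atTop_atTop).eventually_gt_atTop _).and
      (eventually_gt_atTop 0)).exists
  have hKR : (0 : ℝ) < K := by exact_mod_cast hK0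
  have hKθ : (0 : ℝ) < (K : ℝ) ^ θ := Real.rpow_pos_of_pos hKR θ
  set ε : ℝ := min (c₁ / 2) (1 / (2 * b 0)) with hε
  have hb00 := hb0 0
  have hε0 : 0 < ε := lt_min (by positivity) (by positivity)
  refine ⟨ε / (K : ℝ) ^ θ, by positivity, C, hC, fun n => ⟨?_, hαC n⟩⟩
  obtain ⟨m, hm⟩ : ∃ m, m + 1 = K * (n + 1) :=
    ⟨K * (n + 1) - 1, Nat.sub_add_cancel (Nat.mul_pos hK0 n.succ_pos)⟩
  have hmR : (m : ℝ) + 1 = K * (n + 1) := by exact_mod_cast hm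
  have hx : (0 : ℝ) < n + 1 := by positivity
  have hbm := hb0 m
  have hgrowth : b n ≤ (K : ℝ) ^ θ * b m := by
    have hnm : n ≤ m := by nlinarith
    have := hgrow hnm
    simp only [hmR] at this
    rw [Real.mul_rpow hKR.le hx.le, mul_comm ((K : ℝ) ^ θ), mul_assoc] at this
    exact le_of_mul_le_mul_left this (by positivity)
  have hδ1 : ε * b m < 1 :=
    calc ε * b m ≤ 1 / (2 * b 0) * b 0 := by
          gcongr
          · exact min_le_right _ _
          · exact hb (Nat.zero_le m)
      _ = 1 / 2 := by field_simp
      _ < 1 := by norm_num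
  have hδ0 : 0 < ε * b m := by positivity
  have hgoal : ε * b m ≤ α n := by
    by_contra! hlt
    have key := mul_sub_le_sum_of_tsum_le (hb.const_mul hc₁.le) hα hα0 hδ0.le m n hlt.le
      (hlower _ ⟨hδ0, hδ1⟩)
    have hbound : (n + 1) * b m * (K * (c₁ / 2)) ≤
        (n + 1) * b m * (C / (1 - θ) * (K : ℝ) ^ θ) :=
      calc (n + 1) * b m * (K * (c₁ / 2)) = (m + 1) * (c₁ * b m - c₁ / 2 * b m) := by
            rw [hmR]; ring
        _ ≤ (m + 1) * (c₁ * b m - ε * b m) := by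
            gcongr
            exact min_le_left _ _
        _ ≤ _ := key
        _ ≤ ∑ i ∈ Finset.range (n + 1), C * b i := Finset.sum_le_sum fun i _ => hαC i
        _ ≤ C * ((n + 1) * b n / (1 - θ)) := by
            rw [← Finset.mul_sum]
            gcongr
            exact havg n
        _ ≤ C * ((n + 1) * ((K : ℝ) ^ θ * b m) / (1 - θ)) := by gcongr
        _ = _ := by ring
    have hdiv := le_of_mul_le_mul_left hbound (by positivity)
    have hsplit : (K : ℝ) = (K : ℝ) ^ (1 - θ) * (K : ℝ) ^ θ := by
      rw [← Real.rpow_add hKR]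
      simp
    rw [div_lt_iff₀ (by positivity)] at hK
    have := mul_lt_mul_of_pos_right hK hKθ
    have heq : (K : ℝ) * (c₁ / 2) = (K : ℝ) ^ (1 - θ) * (c₁ / 2) * (K : ℝ) ^ θ := by
      conv_lhs => rw [hsplit]
      ring
    linarith
  calc ε / (K : ℝ) ^ θ * b n ≤ ε / (K : ℝ) ^ θ * ((K : ℝ) ^ θ * b m) := by gcongr
    _ = ε * b m := by field_simp
    _ ≤ α n := hgoal

/-- **Lemma 3.1.** Let `β ∈ (0,1]`, `(a_n)` a nonnegative decreasing sequence (here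
0-indexed, `a n = a_{n+1}`), and `ρ : [1,∞) → (0,∞)` increasing with `ρ(x)/x^γ`
decreasing for some `γ ∈ (0,1/β)`.  If there is `B > 0` such that for every
`δ ∈ (0,1)`, with `h_{β,δ}(t) = max(t^β − δ, 0)`,
`∑_n h_{β,δ}(1/(Bρ(n))) ≤ ∑_n h_{β,δ}(a_n) ≤ ∑_n h_{β,δ}(B/ρ(n))`,
then `a_n ≍ 1/ρ(n)`. -/
theorem lemma_3_1 (β : ℝ) (hβ : β ∈ Ioc (0 : ℝ) 1)
    (a : ℕ → ℝ) (ha_nonneg : ∀ n, 0 ≤ a n) (ha_anti : Antitone a)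
    (ρ : ℝ → ℝ) (hρ_mono : MonotoneOn ρ (Ici 1)) (hρ_pos : ∀ x ∈ Ici (1 : ℝ), 0 < ρ x)
    (γ : ℝ) (hγ0 : 0 < γ) (hγ : γ < 1 / β)
    (hρ_dec : AntitoneOn (fun x => ρ x / x ^ γ) (Ici 1))
    (hB : ∃ B > 0, ∀ δ ∈ Ioo (0 : ℝ) 1,
      (∑' n : ℕ, ENNReal.ofReal (max ((1 / (B * ρ (n + 1))) ^ β - δ) 0)
          ≤ ∑' n : ℕ, ENNReal.ofReal (max (a n ^ β - δ) 0)) ∧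
      (∑' n : ℕ, ENNReal.ofReal (max (a n ^ β - δ) 0)
          ≤ ∑' n : ℕ, ENNReal.ofReal (max ((B / ρ (n + 1)) ^ β - δ) 0))) :
    ∃ c > 0, ∃ C > 0, ∀ n : ℕ, c / ρ (n + 1) ≤ a n ∧ a n ≤ C / ρ (n + 1) := by
  obtain ⟨hβ0, -⟩ := hβ
  obtain ⟨B, hB0, hB⟩ := hB
  have hmem : ∀ n : ℕ, (n : ℝ) + 1 ∈ Ici (1 : ℝ) := fun n => by simp
  have hρ0 : ∀ n : ℕ, 0 < ρ (n + 1) := fun n => hρ_pos _ (hmem n)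
  have hcast : ∀ {m n : ℕ}, m ≤ n → (m : ℝ) + 1 ≤ n + 1 := fun h => by gcongr
  have hlow : ∀ n : ℕ, (1 / (B * ρ (n + 1))) ^ β = (1 / B) ^ β * (1 / ρ (n + 1)) ^ β := fun n => by
    rw [← Real.mul_rpow (by positivity) (one_div_pos.mpr (hρ0 n)).le, one_div_mul_one_div]
  have hupp : ∀ n : ℕ, (B / ρ (n + 1)) ^ β = B ^ β * (1 / ρ (n + 1)) ^ β := fun n => by
    rw [← Real.mul_rpow hB0.le (one_div_pos.mpr (hρ0 n)).le, mul_one_div]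
  simp only [hlow, hupp] at hB
  have hgrow : Monotone fun n : ℕ => ((n : ℝ) + 1) ^ (γ * β) * (1 / ρ (n + 1)) ^ β := by
    intro m n hmn
    have hm : (0 : ℝ) < m + 1 := by positivity
    have hn : (0 : ℝ) < n + 1 := by positivity
    have hrewrite : ∀ k : ℕ, ((k : ℝ) + 1) ^ (γ * β) * (1 / ρ (k + 1)) ^ β =
        ((ρ (k + 1) / ((k : ℝ) + 1) ^ γ)⁻¹) ^ β := fun k => by
      have hk : (0 : ℝ) < k + 1 := by positivity
      rw [Real.rpow_mul hk.le, ← Real.mul_rpow (by positivity) (one_div_pos.mpr (hρ0 k)).le,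
        inv_div, mul_one_div]
    simp only [hrewrite]
    have := hρ0 m
    have := hρ0 n
    gcongr ?_ ^ β
    exact inv_anti₀ (by positivity) (hρ_dec (hmem m) (hmem n) (hcast hmn))
  obtain ⟨c, hc, C, hC, h⟩ := comparable_of_truncated_sums (θ := γ * β) (by positivity)
    ((lt_div_iff₀ hβ0).mp hγ) (α := fun n => a n ^ β) (b := fun n : ℕ => (1 / ρ (n + 1)) ^ β)
    (fun m n hmn => Real.rpow_le_rpow (ha_nonneg n) (ha_anti hmn) hβ0.le)
    (fun n => Real.rpow_nonneg (ha_nonneg n) β)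
    (fun m n hmn => Real.rpow_le_rpow (one_div_pos.mpr (hρ0 n)).le
      (one_div_le_one_div_of_le (hρ0 m) (hρ_mono (hmem m) (hmem n) (hcast hmn))) hβ0.le)
    (fun n => Real.rpow_pos_of_pos (one_div_pos.mpr (hρ0 n)) β)
    hgrow (Real.rpow_pos_of_pos (one_div_pos.mpr hB0) β) (Real.rpow_pos_of_pos hB0 β)
    (fun δ hδ => (hB δ hδ).1) (fun δ hδ => (hB δ hδ).2)
  have hroot : ∀ (d : ℝ), 0 < d → ∀ n : ℕ,
      (d ^ β⁻¹ / ρ (n + 1)) ^ β = d * (1 / ρ (n + 1)) ^ β := fun d hd n => by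
    rw [← mul_one_div, Real.mul_rpow (by positivity) (one_div_pos.mpr (hρ0 n)).le,
      Real.rpow_inv_rpow hd.le hβ0.ne']
  refine ⟨c ^ β⁻¹, by positivity, C ^ β⁻¹, by positivity, fun n => ?_⟩
  have hρn := hρ0 n
  rw [← Real.rpow_le_rpow_iff (by positivity) (ha_nonneg n) hβ0,
    ← Real.rpow_le_rpow_iff (ha_nonneg n) (by positivity) hβ0, hroot c hc, hroot C hC]
  exact h n
end

section
/- Proposition 5.6. Let α > −1 and let A²_α be the standard Bergman space on the unit disc 𝔻 with weight ω_α²(z) = ((α+1)/π)(1−|z|²)^α and reproducing kernel K^α_z(w) = (1 − z̄w)^{−(2+α)}. Let (R_n)_{n≥1} ∈ ℒ_{ω_α} with centers z_n and let p ∈ (0,1). Then C_p(A²_α,(R_n)) < ∞ if and only if p > 1/(2+α). -/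
open MeasureTheory Metric Filter Set
open scoped ENNReal Topology

noncomputable section

/-- `(D(z_n, δτ(z_n)))_n` is a lattice of `Ω` (class `ℒ_ω`), with parameter `B`. -/
structure IsLattice (Ω : Set ℂ) (τ : ℂ → ℝ) (z : ℕ → ℂ) (δ B : ℝ) : Prop where
  delta_pos : 0 < δ
  B_gt_one : 1 < B
  center_mem : ∀ n, z n ∈ Ω
  cover : (⋃ n, ball (z n) (δ * τ (z n))) = Ω
  coverB : (⋃ n, ball (z n) (B * δ * τ (z n))) = Ω
  disj : Pairwise (Function.onFun Disjoint fun n => ball (z n) (δ / B * τ (z n)))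
  nested : ∀ n, ∀ w ∈ ball (z n) (δ * τ (z n)), ball w (δ * τ w) ⊆ ball (z n) (B * δ * τ (z n))
  finite_mult : ∃ N : ℕ, ∀ n,
    {m | (ball (z n) (B * δ * τ (z n)) ∩ ball (z m) (B * δ * τ (z m))).Nonempty}.Finite ∧
    {m | (ball (z n) (B * δ * τ (z n)) ∩ ball (z m) (B * δ * τ (z m))).Nonempty}.ncard ≤ N

/-- The Berezin transform, on the standard Bergman space `A²_α`, of the Toeplitz operator
`T_{ν}` with `ν = dA|_{R}`:
`ν̃(z) = (∫_{R} |K^α_z(ζ)|² ω_α²(ζ) dA(ζ)) / ‖K^α_z‖²` where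
`K^α_z(ζ) = (1−z̄ζ)^{−(2+α)}`, `ω_α²(ζ) = ((α+1)/π)(1−|ζ|²)^α` and
`‖K^α_z‖² = (1−|z|²)^{−(2+α)}`. -/
noncomputable def nuTildeStd (α : ℝ) (R : Set ℂ) (z : ℂ) : ℝ :=
  (∫ ζ in R, ((α + 1) / Real.pi) * (1 - ‖ζ‖ ^ 2) ^ α /
      ‖(1 : ℂ) - (starRingEnd ℂ) z * ζ‖ ^ (2 * (2 + α))) * (1 - ‖z‖ ^ 2) ^ (2 + α)

lemma normSq_one_sub_conj_mul (a z : ℂ) :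
    ‖1 - (starRingEnd ℂ) a * z‖ ^ 2 = ‖a - z‖ ^ 2 + (1 - ‖a‖ ^ 2) * (1 - ‖z‖ ^ 2) := by
  simp only [← Complex.normSq_eq_norm_sq, Complex.normSq_apply]
  simp
  ring

lemma one_sub_norm_sq_pos {z : ℂ} (hz : ‖z‖ < 1) : 0 < 1 - ‖z‖ ^ 2 := by
  nlinarith [norm_nonneg z]

lemma one_sub_norm_le_norm_one_sub_conj_mul {a : ℂ} (ha : ‖a‖ < 1) (z : ℂ) :
    1 - ‖z‖ ≤ ‖1 - (starRingEnd ℂ) a * z‖ := by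
  have h := norm_sub_norm_le (1 : ℂ) ((starRingEnd ℂ) a * z)
  rw [norm_one, norm_mul, RCLike.norm_conj] at h
  nlinarith [norm_nonneg z]

lemma norm_one_sub_conj_mul_pos {a z : ℂ} (ha : ‖a‖ < 1) (hz : ‖z‖ < 1) :
    0 < ‖1 - (starRingEnd ℂ) a * z‖ :=
  (sub_pos.2 hz).trans_le (one_sub_norm_le_norm_one_sub_conj_mul ha z)

/-- The involutive automorphism of the disc exchanging `0` and `a`. -/
def discInvolution (a z : ℂ) : ℂ := (a - z) / (1 - (starRingEnd ℂ) a * z)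

lemma one_sub_norm_discInvolution_sq {a z : ℂ} (ha : ‖a‖ < 1) (hz : ‖z‖ < 1) :
    1 - ‖discInvolution a z‖ ^ 2 =
      (1 - ‖a‖ ^ 2) * (1 - ‖z‖ ^ 2) / ‖1 - (starRingEnd ℂ) a * z‖ ^ 2 := by
  have h := norm_one_sub_conj_mul_pos ha hz
  rw [discInvolution, norm_div, div_pow, eq_div_iff (by positivity), sub_mul,
    div_mul_cancel₀ _ (by positivity), one_mul, normSq_one_sub_conj_mul]
  ring

lemma norm_discInvolution_lt_one {a z : ℂ} (ha : ‖a‖ < 1) (hz : ‖z‖ < 1) :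
    ‖discInvolution a z‖ < 1 := by
  have h : 0 < 1 - ‖discInvolution a z‖ ^ 2 := by
    have := norm_one_sub_conj_mul_pos ha hz
    have := one_sub_norm_sq_pos ha
    have := one_sub_norm_sq_pos hz
    rw [one_sub_norm_discInvolution_sq ha hz]
    positivity
  nlinarith [norm_nonneg (discInvolution a z)]

lemma norm_discInvolution_sub_sq {a z w : ℂ} (ha : ‖a‖ < 1) (hz : ‖z‖ < 1) (hw : ‖w‖ < 1) :
    ‖discInvolution a z - discInvolution a w‖ ^ 2 = ‖z - w‖ ^ 2 * (1 - ‖a‖ ^ 2) ^ 2 /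
      (‖1 - (starRingEnd ℂ) a * z‖ ^ 2 * ‖1 - (starRingEnd ℂ) a * w‖ ^ 2) := by
  have h1 := norm_pos_iff.1 (norm_one_sub_conj_mul_pos ha hz)
  have h2 := norm_pos_iff.1 (norm_one_sub_conj_mul_pos ha hw)
  have h3 : discInvolution a z - discInvolution a w = (w - z) * ((1 - ‖a‖ ^ 2 : ℝ) : ℂ) /
      ((1 - (starRingEnd ℂ) a * z) * (1 - (starRingEnd ℂ) a * w)) := by
    rw [discInvolution, discInvolution, div_sub_div _ _ h1 h2]
    congr 1
    push_cast
    rw [← Complex.mul_conj']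
    ring
  rw [h3, norm_div, norm_mul, norm_mul, Complex.norm_real, div_pow, mul_pow, mul_pow,
    Real.norm_eq_abs, sq_abs, norm_sub_rev]

/-- Pseudohyperbolic separation is invariant under the disc involutions. -/
lemma separated_discInvolution {κ : ℝ} {a z w : ℂ} (ha : ‖a‖ < 1) (hz : ‖z‖ < 1) (hw : ‖w‖ < 1)
    (h : κ ^ 2 * ((1 - ‖z‖ ^ 2) * (1 - ‖w‖ ^ 2)) ≤ ‖z - w‖ ^ 2) :
    κ ^ 2 * ((1 - ‖discInvolution a z‖ ^ 2) * (1 - ‖discInvolution a w‖ ^ 2)) ≤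
      ‖discInvolution a z - discInvolution a w‖ ^ 2 := by
  have h1 := norm_one_sub_conj_mul_pos ha hz
  have h2 := norm_one_sub_conj_mul_pos ha hw
  rw [one_sub_norm_discInvolution_sq ha hz, one_sub_norm_discInvolution_sq ha hw,
    norm_discInvolution_sub_sq ha hz hw, div_mul_div_comm, ← mul_div_assoc]
  refine div_le_div_of_nonneg_right ?_ (by positivity)
  calc _ = κ ^ 2 * ((1 - ‖z‖ ^ 2) * (1 - ‖w‖ ^ 2)) * (1 - ‖a‖ ^ 2) ^ 2 := by ring
    _ ≤ _ := mul_le_mul_of_nonneg_right h (sq_nonneg _)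

lemma lintegral_ball_one_sub_norm_sq_rpow_lt_top {s : ℝ} (hs : 1 < s) :
    ∫⁻ u in ball (0 : ℂ) 1, ENNReal.ofReal ((1 - ‖u‖ ^ 2) ^ (s - 2)) < ∞ := by
  have h1 : IntegrableOn (fun y : ℝ => y * (1 - y ^ 2) ^ (s - 2)) (Ioc 0 1) := by
    refine intervalIntegral.integrableOn_deriv_of_nonneg
      (g := fun y : ℝ => -(1 - y ^ 2) ^ (s - 1) / (2 * (s - 1))) ?_ ?_ ?_
    · refine ((ContinuousOn.rpow_const (by fun_prop) ?_).neg).div_const _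
      intro x _
      right; linarith
    · intro y hy
      have hy' : 0 < 1 - y ^ 2 := by nlinarith [hy.1, hy.2]
      have h := ((((hasDerivAt_pow 2 y).const_sub 1).rpow_const (p := s - 1)
        (Or.inl hy'.ne')).neg).div_const (2 * (s - 1))
      refine h.congr_deriv ?_
      have : s - 1 ≠ 0 := by linarith
      rw [show s - 1 - 1 = s - 2 by ring]
      field_simp
      simp [mul_comm]
    · intro y hy
      have hy' : 0 < 1 - y ^ 2 := by nlinarith [hy.1, hy.2]
      have := hy.1
      positivity
  have h2 : Integrable (fun u : ℂ => (Iio (1 : ℝ)).indicator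
      (fun y => (1 - y ^ 2) ^ (s - 2)) ‖u‖) := by
    rw [integrable_fun_norm_addHaar]
    simp only [Complex.finrank_real_complex, smul_eq_mul]
    have h3 : (fun y : ℝ => y ^ (2 - 1) * (Iio (1 : ℝ)).indicator
        (fun y => (1 - y ^ 2) ^ (s - 2)) y) =
        (Iio (1 : ℝ)).indicator (fun y : ℝ => y * (1 - y ^ 2) ^ (s - 2)) := by
      ext y
      by_cases hy : y ∈ Iio (1 : ℝ) <;> simp [hy]
    rw [h3, integrableOn_indicator_iff measurableSet_Iio]
    exact h1.mono_set fun y hy => ⟨hy.2, hy.1.le⟩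
  refine lt_of_le_of_lt ?_ h2.lintegral_lt_top
  rw [← lintegral_indicator measurableSet_ball]
  refine lintegral_mono fun u => ?_
  by_cases hu : u ∈ ball (0 : ℂ) 1
  · have : ‖u‖ ∈ Iio (1 : ℝ) := by simpa using hu
    simp [hu, indicator_of_mem this]
  · simp [hu]

/-- Powers are bounded above and below on compact subintervals of `(0, ∞)`. -/
lemma exists_rpow_bounds (α : ℝ) {l L : ℝ} (hl : 0 < l) (hL : 0 < L) :
    ∃ m M : ℝ, 0 < m ∧ 0 < M ∧ ∀ t x : ℝ, 0 < t → l * t ≤ x → x ≤ L * t →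
      m * t ^ α ≤ x ^ α ∧ x ^ α ≤ M * t ^ α := by
  refine ⟨min (l ^ α) (L ^ α), max (l ^ α) (L ^ α), by positivity, by positivity, ?_⟩
  intro t x ht h1 h2
  have hx : 0 < x := by nlinarith [mul_pos hl ht]
  rw [min_mul_of_nonneg _ _ (by positivity), max_mul_of_nonneg _ _ (by positivity),
    ← Real.mul_rpow hl.le ht.le, ← Real.mul_rpow hL.le ht.le]
  rcases le_total 0 α with h | h
  · exact ⟨(min_le_left _ _).trans (by gcongr), le_trans (by gcongr) (le_max_right _ _)⟩
  · exact ⟨(min_le_right _ _).trans (Real.rpow_le_rpow_of_nonpos hx h2 h),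
      (Real.rpow_le_rpow_of_nonpos (by positivity) h1 h).trans (le_max_left _ _)⟩

/-- A separated sequence in the disc satisfies `∑ (1 - ‖u i‖²) ^ s ≤ C` for `s > 1`. -/
lemma exists_tsum_rpow_le_of_separated {κ s : ℝ} (hκ : 0 < κ) (hs : 1 < s) :
    ∃ C : ℝ, 0 ≤ C ∧ ∀ u : ℕ → ℂ, (∀ i, ‖u i‖ < 1) →
      (∀ i j, i ≠ j → κ ^ 2 * ((1 - ‖u i‖ ^ 2) * (1 - ‖u j‖ ^ 2)) ≤ ‖u i - u j‖ ^ 2) →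
      ∑' i, ENNReal.ofReal ((1 - ‖u i‖ ^ 2) ^ s) ≤ ENNReal.ofReal C := by
  set c : ℝ := min (1 / 8) (κ / 4) with hc
  have hc0 : 0 < c := by positivity
  have hc1 : c ≤ 1 / 8 := min_le_left _ _
  have hc2 : c ≤ κ / 4 := min_le_right _ _
  obtain ⟨m, M, hm, -, hmM⟩ := exists_rpow_bounds (s - 2) (l := 1 / 2) (L := 3 / 2)
    (by norm_num) (by norm_num)
  set I := ∫⁻ u in ball (0 : ℂ) 1, ENNReal.ofReal ((1 - ‖u‖ ^ 2) ^ (s - 2))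
  have hIt : I < ∞ := lintegral_ball_one_sub_norm_sq_rpow_lt_top hs
  set k : ℝ := m * c ^ 2 * Real.pi with hk
  have hk0 : 0 < k := by positivity
  refine ⟨k⁻¹ * I.toReal, by positivity, fun u hu hsep => ?_⟩
  have ht := fun i => one_sub_norm_sq_pos (hu i)
  -- `1 - ‖·‖²` is nearly constant on each ball
  have hvar : ∀ i, ∀ w ∈ ball (u i) (c * (1 - ‖u i‖ ^ 2)),
      |‖w‖ ^ 2 - ‖u i‖ ^ 2| ≤ 3 * (c * (1 - ‖u i‖ ^ 2)) := by
    intro i w hw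
    rw [mem_ball, dist_eq_norm] at hw
    have h1 := (abs_norm_sub_norm_le w (u i)).trans hw.le
    have h2 := abs_le.1 h1
    have := ht i
    have := hu i
    have := norm_nonneg (u i)
    rw [show ‖w‖ ^ 2 - ‖u i‖ ^ 2 = (‖w‖ - ‖u i‖) * (‖w‖ + ‖u i‖) by ring, abs_mul,
      abs_of_nonneg (by positivity : 0 ≤ ‖w‖ + ‖u i‖), mul_comm]
    gcongr
    nlinarith
  have hlow : ∀ i, ENNReal.ofReal k * ENNReal.ofReal ((1 - ‖u i‖ ^ 2) ^ s) ≤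
      ∫⁻ w in ball (u i) (c * (1 - ‖u i‖ ^ 2)), ENNReal.ofReal ((1 - ‖w‖ ^ 2) ^ (s - 2)) := by
    intro i
    have hti := ht i
    calc _ = ∫⁻ w in ball (u i) (c * (1 - ‖u i‖ ^ 2)),
          ENNReal.ofReal (m * (1 - ‖u i‖ ^ 2) ^ (s - 2)) := by
          rw [setLIntegral_const, Complex.volume_ball, ← ENNReal.ofReal_mul hk0.le,
            ← ENNReal.ofReal_pow (by positivity), ← ENNReal.ofReal_coe_nnreal,
            ← ENNReal.ofReal_mul (by positivity), ← ENNReal.ofReal_mul (by positivity)]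
          congr 1
          have : (1 - ‖u i‖ ^ 2) ^ s = (1 - ‖u i‖ ^ 2) ^ (s - 2) * (1 - ‖u i‖ ^ 2) ^ 2 := by
            rw [← Real.rpow_natCast (1 - ‖u i‖ ^ 2) 2, ← Real.rpow_add hti]
            norm_num
          rw [this, hk, NNReal.coe_real_pi]
          ring
      _ ≤ _ := by
          refine setLIntegral_mono' measurableSet_ball fun w hw => ENNReal.ofReal_le_ofReal ?_
          have h := abs_le.1 (hvar i w hw)
          exact (hmM _ _ hti (by nlinarith) (by nlinarith)).1
  have hdisj : Pairwise (Function.onFun Disjoint fun i => ball (u i) (c * (1 - ‖u i‖ ^ 2))) := by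
    intro i j hij
    rw [Function.onFun, Set.disjoint_left]
    intro w hi hj
    have h1 := abs_le.1 (hvar i w hi)
    have h2 := abs_le.1 (hvar j w hj)
    rw [mem_ball] at hi hj
    have h3 := hsep i j hij
    have h4 : ‖u i - u j‖ < c * ((1 - ‖u i‖ ^ 2) + (1 - ‖u j‖ ^ 2)) := by
      rw [← dist_eq_norm]
      linarith [dist_triangle_left (u i) (u j) w]
    have hti := ht i
    have htj := ht j
    set a := 1 - ‖u i‖ ^ 2 with ha
    set b := 1 - ‖u j‖ ^ 2 with hb
    have hca : c * a ≤ 1 / 8 * a := by gcongr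
    have hcb : c * b ≤ 1 / 8 * b := by gcongr
    have hab : 5 * b ≤ 11 * a := by linarith
    have hba : 5 * a ≤ 11 * b := by linarith
    have h5 : (a + b) ^ 2 ≤ 16 * (a * b) := by nlinarith
    have h6 : ‖u i - u j‖ ^ 2 < (c * (a + b)) ^ 2 := by gcongr
    have h7 : (c * (a + b)) ^ 2 ≤ (κ / 4) ^ 2 * (16 * (a * b)) := by
      rw [mul_pow]
      gcongr
    linarith
  calc _ = ENNReal.ofReal k⁻¹ * ∑' i, ENNReal.ofReal k * ENNReal.ofReal ((1 - ‖u i‖ ^ 2) ^ s) := by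
        rw [ENNReal.tsum_mul_left, ← mul_assoc, ← ENNReal.ofReal_mul (by positivity),
          inv_mul_cancel₀ hk0.ne', ENNReal.ofReal_one, one_mul]
    _ ≤ ENNReal.ofReal k⁻¹ * I := by
        gcongr
        refine (ENNReal.tsum_le_tsum hlow).trans ?_
        rw [← lintegral_iUnion (fun i => measurableSet_ball) hdisj]
        refine lintegral_mono_set (iUnion_subset fun i w hw => ?_)
        have h := abs_le.1 (hvar i w hw)
        have := ht i
        rw [mem_ball_zero_iff]
        nlinarith [norm_nonneg w]
    _ = _ := by
        rw [ENNReal.ofReal_mul (by positivity), ENNReal.ofReal_toReal hIt.ne]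

lemma le_one_sub_norm_of_ball_subset {a : ℂ} {r : ℝ} (ha : ‖a‖ < 1)
    (h : ball a r ⊆ ball (0 : ℂ) 1) : r ≤ 1 - ‖a‖ := by
  by_contra! hr
  obtain ⟨v, hv, hav⟩ : ∃ v : ℂ, ‖v‖ = 1 ∧ a = ‖a‖ * v := by
    rcases eq_or_ne a 0 with rfl | h0
    · exact ⟨1, by simp, by simp⟩
    · have h0' : (‖a‖ : ℂ) ≠ 0 := by simpa using h0
      exact ⟨a / ‖a‖, by simp [h0], by field_simp⟩
  have hmem : v ∈ ball a r := by
    rw [mem_ball, dist_eq_norm]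
    have h1 : v - a = ((1 - ‖a‖ : ℝ) : ℂ) * v := by
      push_cast
      linear_combination -hav
    rw [h1, norm_mul, hv, mul_one, Complex.norm_real, Real.norm_of_nonneg (by linarith)]
    exact hr
  have := h hmem
  rw [mem_ball_zero_iff, hv] at this
  exact lt_irrefl _ this

lemma norm_one_sub_conj_mul_comm (a z : ℂ) :
    ‖1 - (starRingEnd ℂ) a * z‖ = ‖1 - (starRingEnd ℂ) z * a‖ := by
  rw [← RCLike.norm_conj]
  simp [mul_comm]

/-- Two-sided estimate of the Berezin transform of a ball of radius comparable to the distance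
to the unit circle. -/
lemma exists_nuTildeStd_bounds {α δ B : ℝ} (hα : -1 < α) (hδ : 0 < δ) (hB : 1 < B) :
    ∃ m M : ℝ, 0 < m ∧ 0 < M ∧ ∀ a w : ℂ, ‖a‖ < 1 → ‖w‖ < 1 →
      B * δ * (1 - ‖a‖ ^ 2) ≤ 1 - ‖a‖ →
      m * (1 - ‖discInvolution a w‖ ^ 2) ^ (2 + α) ≤
          nuTildeStd α (ball a (δ * (1 - ‖a‖ ^ 2))) w ∧
        nuTildeStd α (ball a (δ * (1 - ‖a‖ ^ 2))) w ≤
          M * (1 - ‖discInvolution a w‖ ^ 2) ^ (2 + α) := by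
  have hθ : 0 < B⁻¹ := by positivity
  have hθ1 : B⁻¹ < 1 := inv_lt_one_of_one_lt₀ hB
  set θ := B⁻¹ with hθdef
  have hα1 : 0 < α + 1 := by linarith
  have hpi := Real.pi_pos
  obtain ⟨m₁, M₁, hm₁, hM₁, h₁⟩ := exists_rpow_bounds α (l := (1 - θ) / 2) (L := 2 * (1 + θ))
    (by linarith) (by linarith)
  obtain ⟨m₂, M₂, hm₂, hM₂, h₂⟩ := exists_rpow_bounds (2 * (2 + α)) (l := 1 - θ) (L := 1 + θ)
    (by linarith) (by linarith)
  refine ⟨(α + 1) / Real.pi * (m₁ / M₂) * (Real.pi * δ ^ 2),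
    (α + 1) / Real.pi * (M₁ / m₂) * (Real.pi * δ ^ 2), by positivity, by positivity, ?_⟩
  intro a w ha hw hR
  have hta := one_sub_norm_sq_pos ha
  have htw := one_sub_norm_sq_pos hw
  have hD := norm_one_sub_conj_mul_pos hw ha
  have hR' : δ * (1 - ‖a‖ ^ 2) ≤ θ * (1 - ‖a‖) := by
    rw [hθdef, le_inv_mul_iff₀ (by linarith)]
    linarith
  have hbase := one_sub_norm_le_norm_one_sub_conj_mul hw a
  set f : ℂ → ℝ := fun ζ => ((α + 1) / Real.pi) * (1 - ‖ζ‖ ^ 2) ^ α /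
      ‖(1 : ℂ) - (starRingEnd ℂ) w * ζ‖ ^ (2 * (2 + α)) with hf
  set D := ‖1 - (starRingEnd ℂ) w * a‖ with hDdef
  have hbd : ∀ ζ ∈ ball a (δ * (1 - ‖a‖ ^ 2)),
      (α + 1) / Real.pi * (m₁ / M₂) * ((1 - ‖a‖ ^ 2) ^ α / D ^ (2 * (2 + α))) ≤ f ζ ∧
      f ζ ≤ (α + 1) / Real.pi * (M₁ / m₂) * ((1 - ‖a‖ ^ 2) ^ α / D ^ (2 * (2 + α))) := by
    intro ζ hζ
    rw [mem_ball, dist_eq_norm] at hζ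
    have hdist : ‖ζ - a‖ ≤ θ * (1 - ‖a‖) := hζ.le.trans hR'
    have h3 := abs_le.1 ((abs_norm_sub_norm_le ζ a).trans hdist)
    have h4 : |‖1 - (starRingEnd ℂ) w * ζ‖ - D| ≤ θ * D := by
      refine (abs_norm_sub_norm_le _ _).trans ?_
      rw [show (1 - (starRingEnd ℂ) w * ζ) - (1 - (starRingEnd ℂ) w * a) =
        (starRingEnd ℂ) w * (a - ζ) by ring, norm_mul, RCLike.norm_conj, norm_sub_rev]
      calc ‖w‖ * ‖ζ - a‖ ≤ 1 * (θ * (1 - ‖a‖)) := by gcongr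
        _ ≤ θ * D := by rw [one_mul]; gcongr
    have h5 := abs_le.1 h4
    have hna := norm_nonneg a
    have hnz := norm_nonneg ζ
    have hz1 : ‖ζ‖ < 1 := by nlinarith
    have h6 := h₁ (1 - ‖a‖ ^ 2) (1 - ‖ζ‖ ^ 2) hta
      (by nlinarith [mul_pos (sub_pos.2 hθ1) (sub_pos.2 ha)])
      (by nlinarith [mul_pos (sub_pos.2 ha) hθ])
    have h7 := h₂ D ‖1 - (starRingEnd ℂ) w * ζ‖ hD (by linarith) (by linarith)
    have hDq : 0 < D ^ (2 * (2 + α)) := by positivity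
    have htz : 0 < 1 - ‖ζ‖ ^ 2 := one_sub_norm_sq_pos hz1
    have hEq : 0 < ‖1 - (starRingEnd ℂ) w * ζ‖ ^ (2 * (2 + α)) :=
      lt_of_lt_of_le (by positivity) h7.1
    simp only [hf]
    constructor
    · calc _ = (α + 1) / Real.pi * (m₁ * (1 - ‖a‖ ^ 2) ^ α) / (M₂ * D ^ (2 * (2 + α))) := by
            field_simp
        _ ≤ _ := by
            gcongr
            · exact h6.1
            · exact h7.2
    · calc _ ≤ (α + 1) / Real.pi * (M₁ * (1 - ‖a‖ ^ 2) ^ α) / (m₂ * D ^ (2 * (2 + α))) := by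
            gcongr
            · exact h6.2
            · exact h7.1
        _ = _ := by field_simp
  have hvol : volume.real (ball a (δ * (1 - ‖a‖ ^ 2))) =
      Real.pi * δ ^ 2 * (1 - ‖a‖ ^ 2) ^ 2 := by
    rw [Measure.real, Complex.volume_ball, ENNReal.toReal_mul, ENNReal.toReal_pow,
      ENNReal.toReal_ofReal (by positivity)]
    simp
    ring
  have hfin : volume (ball a (δ * (1 - ‖a‖ ^ 2))) ≠ ∞ := measure_ball_lt_top.ne
  have hfint : IntegrableOn f (ball a (δ * (1 - ‖a‖ ^ 2))) := by
    refine Measure.integrableOn_of_bounded hfin ?_ (M := (α + 1) / Real.pi * (M₁ / m₂) *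
      ((1 - ‖a‖ ^ 2) ^ α / D ^ (2 * (2 + α)))) ?_
    · refine Measurable.aestronglyMeasurable ?_
      refine Measurable.div ?_ ?_
      · exact ((measurable_norm.pow_const 2).const_sub 1).pow_const α |>.const_mul _
      · exact Measurable.pow_const
          (((measurable_id.const_mul _).const_sub _).norm) _
    · refine (ae_restrict_iff' measurableSet_ball).2 (ae_of_all _ fun ζ hζ => ?_)
      have h := hbd ζ hζ
      rw [Real.norm_of_nonneg (le_trans (by positivity) h.1)]
      exact h.2
  have hX : (1 - ‖discInvolution a w‖ ^ 2) ^ (2 + α) =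
      (1 - ‖a‖ ^ 2) ^ α / D ^ (2 * (2 + α)) * (1 - ‖a‖ ^ 2) ^ 2 * (1 - ‖w‖ ^ 2) ^ (2 + α) := by
    rw [one_sub_norm_discInvolution_sq ha hw, norm_one_sub_conj_mul_comm, ← hDdef,
      Real.div_rpow (by positivity) (by positivity), Real.mul_rpow hta.le htw.le,
      Real.rpow_mul hD.le, Real.rpow_add hta, Real.rpow_two, Real.rpow_two]
    ring
  have hconst (c : ℝ) : ∫ _ in ball a (δ * (1 - ‖a‖ ^ 2)), c =
      Real.pi * δ ^ 2 * (1 - ‖a‖ ^ 2) ^ 2 * c := by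
    rw [setIntegral_const, hvol, smul_eq_mul]
  have hlow := setIntegral_mono_on (integrableOn_const hfin) hfint measurableSet_ball
    fun ζ hζ => (hbd ζ hζ).1
  have hupp := setIntegral_mono_on hfint (integrableOn_const hfin) measurableSet_ball
    fun ζ hζ => (hbd ζ hζ).2
  rw [hconst] at hlow hupp
  have htwq : 0 ≤ (1 - ‖w‖ ^ 2) ^ (2 + α) := by positivity
  rw [hX, nuTildeStd]
  constructor
  · refine le_trans (le_of_eq ?_) (mul_le_mul_of_nonneg_right hlow htwq)
    ring
  · refine (mul_le_mul_of_nonneg_right hupp htwq).trans (le_of_eq ?_)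
    ring

namespace IsLattice

variable {z : ℕ → ℂ} {δ B : ℝ}

lemma norm_center_lt_one (h : IsLattice (ball (0 : ℂ) 1) (fun w => 1 - ‖w‖ ^ 2) z δ B) (n : ℕ) :
    ‖z n‖ < 1 :=
  mem_ball_zero_iff.1 (h.center_mem n)

lemma radius_le (h : IsLattice (ball (0 : ℂ) 1) (fun w => 1 - ‖w‖ ^ 2) z δ B) (n : ℕ) :
    B * δ * (1 - ‖z n‖ ^ 2) ≤ 1 - ‖z n‖ := by
  refine le_one_sub_norm_of_ball_subset (h.norm_center_lt_one n) ?_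
  rw [← h.coverB]
  exact subset_iUnion (fun n => ball (z n) (B * δ * (1 - ‖z n‖ ^ 2))) n

lemma separated (h : IsLattice (ball (0 : ℂ) 1) (fun w => 1 - ‖w‖ ^ 2) z δ B) {i j : ℕ}
    (hij : i ≠ j) :
    (δ / B) ^ 2 * ((1 - ‖z i‖ ^ 2) * (1 - ‖z j‖ ^ 2)) ≤ ‖z i - z j‖ ^ 2 := by
  have hδ := h.delta_pos
  have hB := h.B_gt_one
  have hi := one_sub_norm_sq_pos (h.norm_center_lt_one i)
  have hj := one_sub_norm_sq_pos (h.norm_center_lt_one j)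
  have hd := Set.disjoint_left.1 (h.disj hij)
  have h1 : δ / B * (1 - ‖z i‖ ^ 2) ≤ ‖z i - z j‖ := by
    by_contra! hlt
    exact hd (mem_ball_iff_norm'.2 hlt) (mem_ball_self (by positivity))
  have h2 : δ / B * (1 - ‖z j‖ ^ 2) ≤ ‖z i - z j‖ := by
    by_contra! hlt
    exact hd (mem_ball_self (by positivity)) (mem_ball_iff_norm.2 hlt)
  calc _ = (δ / B * (1 - ‖z i‖ ^ 2)) * (δ / B * (1 - ‖z j‖ ^ 2)) := by ring
    _ ≤ ‖z i - z j‖ * ‖z i - z j‖ := by gcongr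
    _ = _ := (sq _).symm

/-- The discs of a lattice cover circles close to the unit circle, so their radii are not
summable. -/
lemma tsum_one_sub_norm_sq_eq_top
    (h : IsLattice (ball (0 : ℂ) 1) (fun w => 1 - ‖w‖ ^ 2) z δ B) :
    ∑' j, ENNReal.ofReal (1 - ‖z j‖ ^ 2) = ∞ := by
  by_contra hne
  have hδ := h.delta_pos
  have hB := h.B_gt_one
  have htail := ENNReal.tendsto_sum_nat_add _ hne
  obtain ⟨N, hN⟩ := (htail.eventually_lt_const
    (u := ENNReal.ofReal (1 / (2 * δ))) (by simpa using hδ)).exists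
  have hin : ∀ n, ‖z n‖ + δ * (1 - ‖z n‖ ^ 2) < 1 := by
    intro n
    have h1 := h.radius_le n
    have h2 := mul_pos hδ (one_sub_norm_sq_pos (h.norm_center_lt_one n))
    nlinarith
  obtain ⟨ρ, hρ0, hρ1, hρ⟩ : ∃ ρ : ℝ, 1 / 2 ≤ ρ ∧ ρ < 1 ∧
      ∀ n < N, ‖z n‖ + δ * (1 - ‖z n‖ ^ 2) ≤ ρ := by
    clear hN
    induction N with
    | zero => exact ⟨1 / 2, le_rfl, by norm_num, by simp⟩
    | succ k ih =>
      obtain ⟨ρ, h0, h1, h2⟩ := ih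
      refine ⟨max ρ (‖z k‖ + δ * (1 - ‖z k‖ ^ 2)), h0.trans (le_max_left _ _),
        max_lt h1 (hin k), fun n hn => ?_⟩
      rcases Nat.lt_succ_iff_lt_or_eq.1 hn with hn | rfl
      · exact (h2 n hn).trans (le_max_left _ _)
      · exact le_max_right _ _
  have hcov : Icc (-1 / 2 : ℝ) (1 / 2) ⊆
      ⋃ k, ball (z (k + N)).re (δ * (1 - ‖z (k + N)‖ ^ 2)) := by
    intro x hx
    have hx2 : 0 ≤ ρ ^ 2 - x ^ 2 := by nlinarith [hx.1, hx.2]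
    set v : ℂ := ⟨x, √(ρ ^ 2 - x ^ 2)⟩ with hv
    have hvn : ‖v‖ = ρ := by
      rw [← sq_eq_sq₀ (norm_nonneg _) (by linarith), ← Complex.normSq_eq_norm_sq,
        Complex.normSq_apply, hv, Real.mul_self_sqrt hx2]
      ring
    have hvm : v ∈ ⋃ n, ball (z n) (δ * (1 - ‖z n‖ ^ 2)) := by
      rw [h.cover, mem_ball_zero_iff, hvn]
      exact hρ1
    obtain ⟨n, hn⟩ := mem_iUnion.1 hvm
    have hNn : N ≤ n := by
      by_contra! hlt
      have h1 := hρ n hlt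
      rw [mem_ball, dist_eq_norm] at hn
      linarith [norm_sub_norm_le v (z n)]
    refine mem_iUnion.2 ⟨n - N, ?_⟩
    rw [Nat.sub_add_cancel hNn, mem_ball, Real.dist_eq]
    rw [mem_ball, dist_eq_norm] at hn
    exact (Complex.abs_re_le_norm (v - z n)).trans_lt hn
  have hle := (measure_mono (μ := volume) hcov).trans (measure_iUnion_le _)
  simp only [Real.volume_Icc, Real.volume_ball, ← mul_assoc] at hle
  simp only [ENNReal.ofReal_mul (by positivity : 0 ≤ 2 * δ), ENNReal.tsum_mul_left] at hle
  have hlt : ENNReal.ofReal (2 * δ) * ∑' k, ENNReal.ofReal (1 - ‖z (k + N)‖ ^ 2) <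
      ENNReal.ofReal (2 * δ) * ENNReal.ofReal (1 / (2 * δ)) :=
    ENNReal.mul_lt_mul_right (by simpa using hδ) ENNReal.ofReal_ne_top hN
  rw [← ENNReal.ofReal_mul (by positivity), mul_one_div_cancel (by positivity)] at hlt
  norm_num at hle
  exact absurd hle (by simpa using hlt)

end IsLattice

/-- **Proposition 5.6.** Let `α > −1`, `(R_n) ∈ ℒ_{ω_α}` a lattice of the unit disc with
centers `z_n` (for the standard Bergman space `A²_α`, where `τ(z) ≍ 1−|z|²`), and
`p ∈ (0,1)`.  Then `C_p(A²_α,(R_n)) = sup_n ∑_j ν̃_n(z_j)^p < ∞` iff `p > 1/(2+α)`. -/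
theorem proposition_5_6 (α : ℝ) (hα : -1 < α) (p : ℝ) (hp : p ∈ Ioo (0 : ℝ) 1)
    (z : ℕ → ℂ) (δ B : ℝ)
    (hLat : IsLattice (ball (0 : ℂ) 1) (fun w => 1 - ‖w‖ ^ 2) z δ B) :
    (∃ M : ℝ, ∀ n : ℕ, ∑' j : ℕ, ENNReal.ofReal
        ((nuTildeStd α (ball (z n) (δ * (1 - ‖z n‖ ^ 2))) (z j)) ^ p)
      ≤ ENNReal.ofReal M) ↔ 1 / (2 + α) < p := by
  have hδ := hLat.delta_pos
  have hB := hLat.B_gt_one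
  have hz := hLat.norm_center_lt_one
  have hq : 0 < 2 + α := by linarith
  obtain ⟨m, M, hm, hM, hbd⟩ := exists_nuTildeStd_bounds hα hδ hB
  have hX : ∀ n j, 0 < 1 - ‖discInvolution (z n) (z j)‖ ^ 2 := fun n j =>
    one_sub_norm_sq_pos (norm_discInvolution_lt_one (hz n) (hz j))
  constructor
  · rintro ⟨C, hC⟩
    by_contra! hp'
    have hs : (2 + α) * p ≤ 1 := by
      rw [le_div_iff₀ hq] at hp'
      linarith
    have hterm : ∀ j, ENNReal.ofReal (m ^ p * ((1 - ‖z 0‖ ^ 2) / 4)) *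
        ENNReal.ofReal (1 - ‖z j‖ ^ 2) ≤
        ENNReal.ofReal ((nuTildeStd α (ball (z 0) (δ * (1 - ‖z 0‖ ^ 2))) (z j)) ^ p) := by
      intro j
      have h0 := one_sub_norm_sq_pos (hz 0)
      have hj := one_sub_norm_sq_pos (hz j)
      have hXj := hX 0 j
      rw [← ENNReal.ofReal_mul (by positivity)]
      refine ENNReal.ofReal_le_ofReal ?_
      refine le_trans ?_ (Real.rpow_le_rpow (by positivity)
        (hbd (z 0) (z j) (hz 0) (hz j) (hLat.radius_le 0)).1 hp.1.le)
      rw [Real.mul_rpow hm.le (by positivity), ← Real.rpow_mul hXj.le, mul_assoc]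
      gcongr
      refine le_trans ?_ (Real.rpow_le_rpow_of_exponent_ge hXj
        (by nlinarith [norm_nonneg (discInvolution (z 0) (z j))]) hs)
      have hD := norm_one_sub_conj_mul_pos (hz 0) (hz j)
      have hD2 : ‖1 - (starRingEnd ℂ) (z 0) * z j‖ ≤ 2 := by
        refine (norm_sub_le _ _).trans ?_
        rw [norm_one, norm_mul, RCLike.norm_conj]
        nlinarith [hz 0, hz j, norm_nonneg (z 0), norm_nonneg (z j)]
      rw [Real.rpow_one, one_sub_norm_discInvolution_sq (hz 0) (hz j), div_mul_eq_mul_div]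
      gcongr
      nlinarith
    have htop := (ENNReal.tsum_le_tsum hterm).trans (hC 0)
    have hc : 0 < m ^ p * ((1 - ‖z 0‖ ^ 2) / 4) := by
      have := one_sub_norm_sq_pos (hz 0)
      positivity
    rw [ENNReal.tsum_mul_left, hLat.tsum_one_sub_norm_sq_eq_top,
      ENNReal.mul_top (ENNReal.ofReal_pos.2 hc).ne'] at htop
    exact ENNReal.ofReal_ne_top (top_le_iff.1 htop)
  · intro hp'
    have hs : 1 < (2 + α) * p := by
      rw [div_lt_iff₀ hq] at hp'
      linarith
    obtain ⟨C, -, hC⟩ := exists_tsum_rpow_le_of_separated (div_pos hδ (by linarith : 0 < B)) hs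
    refine ⟨M ^ p * C, fun n => ?_⟩
    calc _ ≤ ∑' j, ENNReal.ofReal (M ^ p) *
          ENNReal.ofReal ((1 - ‖discInvolution (z n) (z j)‖ ^ 2) ^ ((2 + α) * p)) := by
          refine ENNReal.tsum_le_tsum fun j => ?_
          have hXj := hX n j
          have h := hbd (z n) (z j) (hz n) (hz j) (hLat.radius_le n)
          rw [← ENNReal.ofReal_mul (by positivity), Real.rpow_mul hXj.le,
            ← Real.mul_rpow hM.le (by positivity)]
          exact ENNReal.ofReal_le_ofReal
            (Real.rpow_le_rpow (le_trans (by positivity) h.1) h.2 hp.1.le)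
      _ ≤ ENNReal.ofReal (M ^ p) * ENNReal.ofReal C := by
          rw [ENNReal.tsum_mul_left]
          gcongr
          exact hC _ (fun i => norm_discInvolution_lt_one (hz n) (hz i)) fun i j hij =>
            separated_discInvolution (hz n) (hz i) (hz j) (hLat.separated hij)
      _ = _ := (ENNReal.ofReal_mul (by positivity)).symm

end
end
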